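/- A group G acting 3-discontinuously and 2-cocompactly on a compactum T without parabolic points is finitely generated. -/

import Mathlib

namespace RHG

/-- Triples with pairwise distinct components. -/
def distinct3 {X : Type*} : Set (X × X × X) :=
  {x | x.1 ≠ x.2.1 ∧ x.1 ≠ x.2.2 ∧ x.2.1 ≠ x.2.2}

/-- Pairs with distinct components. -/
def distinct2 {X : Type*} : Set (X × X) := {x | x.1 ≠ x.2}

/-- The action `act` of `G` on `X` is 3-discontinuous: the induced action on the space of
(ordered) triples of pairwise distinct points is properly discontinuous. -/
def ThreeDisc {G X : Type*} [TopologicalSpace X] (act : G → X → X) : Prop :=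
  ∀ K : Set (X × X × X), IsCompact K → K ⊆ distinct3 →
    Set.Finite {g : G |
      (((fun x : X × X × X => (act g x.1, act g x.2.1, act g x.2.2)) '' K) ∩ K).Nonempty}

/-- The action `act` of `G` on `X` is 2-cocompact: the action on the space of (ordered) pairs
of distinct points is cocompact. -/
def TwoCocompact {G X : Type*} [TopologicalSpace X] (act : G → X → X) : Prop :=
  ∃ K : Set (X × X), IsCompact K ∧ K ⊆ distinct2 ∧
    ∀ x : X × X, x ∈ (distinct2 : Set (X × X)) → ∃ g : G, (act g x.1, act g x.2) ∈ K

/-- `ρ` is an action of the group `G` on `T` by homeomorphisms. -/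
structure IsTopAction (G : Type*) [Group G] (T : Type*) [TopologicalSpace T]
    (ρ : G → T ≃ₜ T) : Prop where
  map_one : ρ 1 = Homeomorph.refl T
  map_mul : ∀ g h : G, ρ (g * h) = (ρ h).trans (ρ g)

/-- The stabilizer of a point for an action by homeomorphisms. -/
def actStab {G : Type*} [Group G] {T : Type*} [TopologicalSpace T]
    (ρ : G → T ≃ₜ T) (hρ : IsTopAction G T ρ) (p : T) : Subgroup G where
  carrier := {g : G | ρ g p = p}
  one_mem' := by
    simp only [Set.mem_setOf_eq, hρ.map_one, Homeomorph.refl_apply, id_eq]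
  mul_mem' := by
    intro a b ha hb
    simp only [Set.mem_setOf_eq] at *
    rw [hρ.map_mul, Homeomorph.trans_apply, hb, ha]
  inv_mem' := by
    intro a ha
    simp only [Set.mem_setOf_eq] at *
    have h1 : ρ (a⁻¹ * a) p = ρ a⁻¹ (ρ a p) := by
      rw [hρ.map_mul, Homeomorph.trans_apply]
    rw [inv_mul_cancel, hρ.map_one, ha] at h1
    simpa using h1.symm

/-- A parabolic point: its stabilizer is infinite and it is the unique fixed point
of its stabilizer. -/
def IsParabolicPt {G : Type*} [Group G] {T : Type*} [TopologicalSpace T]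
    (ρ : G → T ≃ₜ T) (hρ : IsTopAction G T ρ) (p : T) : Prop :=
  Set.Infinite ((actStab ρ hρ p : Set G)) ∧
    ∀ q : T, (∀ g ∈ actStab ρ hρ p, ρ g q = q) → q = p

/-- `T` contains at least three points. -/
def HasThreePts (T : Type*) : Prop := ∃ x y z : T, x ≠ y ∧ x ≠ z ∧ y ≠ z

end RHG

namespace RHG
open Filter Topology Set

set_option linter.unusedSectionVars false

section
variable {G : Type*} [Group G] {T : Type*} [TopologicalSpace T]
  {ρ : G → T ≃ₜ T}

lemma rho_mul (hρ : IsTopAction G T ρ) (g h : G) (x : T) : ρ (g * h) x = ρ g (ρ h x) := by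
  rw [hρ.map_mul]; rfl

lemma rho_one (hρ : IsTopAction G T ρ) (x : T) : ρ 1 x = x := by
  rw [hρ.map_one]; rfl

lemma rho_inv_self (hρ : IsTopAction G T ρ) (g : G) (x : T) : ρ g⁻¹ (ρ g x) = x := by
  rw [← rho_mul hρ, inv_mul_cancel, rho_one hρ]

lemma rho_self_inv (hρ : IsTopAction G T ρ) (g : G) (x : T) : ρ g (ρ g⁻¹ x) = x := by
  rw [← rho_mul hρ, mul_inv_cancel, rho_one hρ]

lemma exists_ulim [CompactSpace T] {ι : Type*} (V : Ultrafilter ι) (f : ι → T) :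
    ∃ a, Tendsto f V (𝓝 a) := by
  obtain ⟨a, -, ha⟩ := isCompact_univ.ultrafilter_le_nhds (V.map f) (by simp)
  exact ⟨a, ha⟩

lemma isOpen_distinct3 [T2Space T] : IsOpen (distinct3 : Set (T × T × T)) := by
  refine IsOpen.inter ?_ (IsOpen.inter ?_ ?_)
  · exact isOpen_ne_fun (by fun_prop) (by fun_prop)
  · exact isOpen_ne_fun (by fun_prop) (by fun_prop)
  · exact isOpen_ne_fun (by fun_prop) (by fun_prop)

/-- limit relation -/
def ZRel {ι : Type*} (V : Ultrafilter ι) (f : ι → G) (ρ : G → T ≃ₜ T) (x y : T) : Prop :=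
  ∀ U ∈ 𝓝 x, ∀ W ∈ 𝓝 y, ∀ᶠ i in (V : Filter ι), ∃ x' ∈ U, ρ (f i) x' ∈ W

lemma ZRel_of_tendsto {ι : Type*} {V : Ultrafilter ι} {f : ι → G} {x y : T} (s : ι → T)
    (hx : Tendsto s V (𝓝 x)) (hy : Tendsto (fun i => ρ (f i) (s i)) V (𝓝 y)) :
    ZRel V f ρ x y := by
  intro U hU W hW
  filter_upwards [hx hU, hy hW] with i h1 h2
  exact ⟨s i, h1, h2⟩

lemma ZRel_no3 [CompactSpace T] [T2Space T] (h3d : ThreeDisc fun (g : G) (x : T) => ρ g x)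
    {ι : Type*} {V : Ultrafilter ι} {f : ι → G}
    (hf : ∀ k, ∀ᶠ i in (V : Filter ι), f i ≠ k) {x1 x2 x3 y1 y2 y3 : T}
    (h1 : ZRel V f ρ x1 y1) (h2 : ZRel V f ρ x2 y2) (h3 : ZRel V f ρ x3 y3)
    (hx12 : x1 ≠ x2) (hx13 : x1 ≠ x3) (hx23 : x2 ≠ x3)
    (hy12 : y1 ≠ y2) (hy13 : y1 ≠ y3) (hy23 : y2 ≠ y3) : False := by
  obtain ⟨Kx, hKx, hxK, hKxs⟩ := exists_compact_subset (isOpen_distinct3 (T := T))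
    (show (x1, x2, x3) ∈ distinct3 from ⟨hx12, hx13, hx23⟩)
  obtain ⟨Ky, hKy, hyK, hKys⟩ := exists_compact_subset (isOpen_distinct3 (T := T))
    (show (y1, y2, y3) ∈ distinct3 from ⟨hy12, hy13, hy23⟩)
  have hfin := h3d (Kx ∪ Ky) (hKx.union hKy) (union_subset hKxs hKys)
  have hev := (eventually_all_finite hfin).2 (fun k _ => hf k)
  obtain ⟨U1, hU1, U23, hU23, hU⟩ := mem_nhds_prod_iff.1 (mem_interior_iff_mem_nhds.1 hxK)
  obtain ⟨U2, hU2, U3, hU3, hU'⟩ := mem_nhds_prod_iff.1 hU23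
  obtain ⟨W1, hW1, W23, hW23, hW⟩ := mem_nhds_prod_iff.1 (mem_interior_iff_mem_nhds.1 hyK)
  obtain ⟨W2, hW2, W3, hW3, hW'⟩ := mem_nhds_prod_iff.1 hW23
  obtain ⟨i, hi, ⟨a1, ha1, hb1⟩, ⟨a2, ha2, hb2⟩, ⟨a3, ha3, hb3⟩⟩ :=
    (hev.and ((h1 U1 hU1 W1 hW1).and ((h2 U2 hU2 W2 hW2).and (h3 U3 hU3 W3 hW3)))).exists
  refine hi (f i) ?_ rfl
  refine ⟨(ρ (f i) a1, ρ (f i) a2, ρ (f i) a3), ⟨(a1, a2, a3), Or.inl (hU ⟨ha1, hU' ⟨ha2, ha3⟩⟩), rfl⟩,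
    Or.inr (hW ⟨hb1, hW' ⟨hb2, hb3⟩⟩)⟩

lemma infinite_fiber [Infinite T] (l : T → T)
    (h : ∀ x1 x2 x3 : T, l x1 ≠ l x2 → l x1 ≠ l x3 → l x2 ≠ l x3 → False) :
    ∃ b, (l ⁻¹' {b}).Infinite := by
  classical
  have : (range l).Finite := by
    by_contra hinf
    obtain ⟨t, ht, hc⟩ := Set.Infinite.exists_subset_card_eq hinf 3
    obtain ⟨a, b, c, hab, hac, hbc, rfl⟩ := Finset.card_eq_three.1 hc
    obtain ⟨x, rfl⟩ := ht (show a ∈ _ by simp)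
    obtain ⟨y, rfl⟩ := ht (show b ∈ _ by simp)
    obtain ⟨z, rfl⟩ := ht (show c ∈ _ by simp)
    exact h x y z hab hac hbc
  have := this.to_subtype
  obtain ⟨b, hb⟩ := Finite.exists_infinite_fiber (rangeFactorization l)
  refine ⟨b, ?_⟩
  rw [← Set.infinite_coe_iff]
  convert hb using 3
  ext x; simp [rangeFactorization, Subtype.ext_iff]

lemma exists_ne_ne_of_infinite {s : Set T} (hs : s.Infinite) (a b : T) :
    ∃ x ∈ s, x ≠ a ∧ x ≠ b := by
  obtain ⟨x, hx, hx2⟩ := hs.exists_notMem_finset (by classical exact {a, b})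
  refine ⟨x, hx, ?_⟩
  simpa using hx2

/-- The convergence property. -/
lemma cross [CompactSpace T] [T2Space T] [Infinite T] (hρ : IsTopAction G T ρ)
    (h3d : ThreeDisc fun (g : G) (x : T) => ρ g x)
    {ι : Type*} (V : Ultrafilter ι) (f : ι → G)
    (hf : ∀ k, ∀ᶠ i in (V : Filter ι), f i ≠ k) :
    ∃ r b : T, ∀ N ∈ 𝓝 r, ∀ B ∈ 𝓝 b, ∀ᶠ i in (V : Filter ι), ∀ x ∉ N, ρ (f i) x ∈ B := by
  choose l hl using fun x : T => exists_ulim V (fun i => ρ (f i) x)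
  choose m hm using fun y : T => exists_ulim V (fun i => ρ (f i)⁻¹ y)
  have hlZ : ∀ x, ZRel V f ρ x (l x) := fun x =>
    ZRel_of_tendsto (fun _ => x) tendsto_const_nhds (hl x)
  have hmZ : ∀ y, ZRel V f ρ (m y) y := fun y =>
    ZRel_of_tendsto (fun i => ρ (f i)⁻¹ y) (hm y) (by simp [rho_self_inv hρ])
  obtain ⟨b, hb⟩ := infinite_fiber l fun x1 x2 x3 h12 h13 h23 =>
    ZRel_no3 h3d hf (hlZ x1) (hlZ x2) (hlZ x3) (fun h => h12 (by rw [h])) (fun h => h13 (by rw [h]))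
      (fun h => h23 (by rw [h])) h12 h13 h23
  obtain ⟨r, hr⟩ := infinite_fiber m fun x1 x2 x3 h12 h13 h23 =>
    ZRel_no3 h3d hf (hmZ x1) (hmZ x2) (hmZ x3) h12 h13 h23 (fun h => h12 (by rw [h]))
      (fun h => h13 (by rw [h])) (fun h => h23 (by rw [h]))
  have hZ : ∀ x y, ZRel V f ρ x y → x = r ∨ y = b := by
    intro x y hxy
    by_contra! hne
    obtain ⟨x', hx', h1, h2⟩ := exists_ne_ne_of_infinite hb x r
    obtain ⟨y', hy', h3, h4⟩ := exists_ne_ne_of_infinite hr y b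
    have e1 : ZRel V f ρ x' b := by have := hlZ x'; rwa [show l x' = b from hx'] at this
    have e2 : ZRel V f ρ r y' := by have := hmZ y'; rwa [show m y' = r from hy'] at this
    exact ZRel_no3 h3d hf hxy e1 e2 h1.symm hne.1 h2 hne.2 h3.symm h4.symm
  refine ⟨r, b, fun N hN B hB => ?_⟩
  by_contra hcon
  rw [Ultrafilter.eventually_not.symm] at hcon
  push Not at hcon
  have : ∀ i, ∃ x, (∃ x ∉ N, ρ (f i) x ∉ B) → (x ∉ N ∧ ρ (f i) x ∉ B) := by
    intro i
    by_cases h : ∃ x ∉ N, ρ (f i) x ∉ B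
    · obtain ⟨x, h1, h2⟩ := h
      exact ⟨x, fun _ => ⟨h1, h2⟩⟩
    · exact ⟨r, fun h' => (h h').elim⟩
  choose s hs using this
  obtain ⟨x, hx⟩ := exists_ulim V s
  obtain ⟨y, hy⟩ := exists_ulim V (fun i => ρ (f i) (s i))
  rcases hZ x y (ZRel_of_tendsto s hx hy) with rfl | rfl
  · obtain ⟨i, h1, h2⟩ := (hcon.and (hx hN)).exists
    exact (hs i h1).1 h2
  · obtain ⟨i, h1, h2⟩ := (hcon.and (hy hB)).exists
    exact (hs i h1).2 h2

end
end RHG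

namespace RHG
open Filter Topology Set

set_option linter.unusedSectionVars false

section
variable {G : Type*} [Group G] {T : Type*} [TopologicalSpace T]
  {ρ : G → T ≃ₜ T}

lemma exists_ultra {S : Set G} (hS : S.Infinite) :
    ∃ V : Ultrafilter G, (∀ k, ∀ᶠ g in (V : Filter G), g ≠ k) ∧ ∀ᶠ g in (V : Filter G), g ∈ S := by
  have := hS.cofinite_inf_principal_neBot
  have hle := Ultrafilter.of_le (cofinite ⊓ 𝓟 S)
  refine ⟨Ultrafilter.of (cofinite ⊓ 𝓟 S), fun k => ?_, ?_⟩
  · exact hle (mem_inf_of_left (by simp))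
  · exact hle (mem_inf_of_right (mem_principal_self S))

/-- A compact set of pairs together with a well chosen small neighbourhood of the diagonal. -/
structure Good (ρ : G → T ≃ₜ T) (K u : Set (T × T)) : Prop where
  Kcov : ∀ x y, x ≠ y → ∃ g, (ρ g x, ρ g y) ∈ K
  Kcl : IsClosed K
  Kd : ∀ x, (x, x) ∉ K
  uop : IsOpen u
  usymm : ∀ x y, (x, y) ∈ u → (y, x) ∈ u
  urefl : ∀ x, (x, x) ∈ u
  sep : ∀ a b, (a, b) ∈ K → ∃ A ∈ 𝓝 a, ∃ B ∈ 𝓝 b, ∀ x ∈ A, ∀ y ∈ B, (x, y) ∉ u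
  two : ∀ x y, ∃ z z', z ≠ z' ∧ (x, z) ∉ u ∧ (y, z) ∉ u ∧ (x, z') ∉ u ∧ (y, z') ∉ u

lemma Good.K_disj {K u : Set (T × T)} (hg : Good ρ K u) {x y : T} (h : (x, y) ∈ K) :
    (x, y) ∉ u := by
  obtain ⟨A, hA, B, hB, h'⟩ := hg.sep x y h
  exact h' x (mem_of_mem_nhds hA) y (mem_of_mem_nhds hB)

/-- conical points, normalized -/
def Con (ρ : G → T ≃ₜ T) (K : Set (T × T)) (p : T) : Prop :=
  ∃ a b, (a, b) ∈ K ∧ ∀ N ∈ 𝓝 p, ∀ A ∈ 𝓝 a, ∀ B ∈ 𝓝 b, ∃ g, ρ g p ∈ A ∧ ∀ x ∉ N, ρ g x ∈ B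

lemma con_of {K u : Set (T × T)} (hρ : IsTopAction G T ρ) (hg : Good ρ K u) {p a b : T}
    (hab : a ≠ b)
    (h : ∀ N ∈ 𝓝 p, ∀ A ∈ 𝓝 a, ∀ B ∈ 𝓝 b, ∃ g, ρ g p ∈ A ∧ ∀ x ∉ N, ρ g x ∈ B) :
    Con ρ K p := by
  obtain ⟨s, hs⟩ := hg.Kcov a b hab
  refine ⟨ρ s a, ρ s b, hs, fun N hN A hA B hB => ?_⟩
  obtain ⟨g, h1, h2⟩ := h N hN _ ((ρ s).continuous.continuousAt hA) _
    ((ρ s).continuous.continuousAt hB)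
  refine ⟨s * g, ?_, fun x hx => ?_⟩
  · rw [rho_mul hρ]; exact h1
  · rw [rho_mul hρ]; exact h2 x hx

lemma con_of_ultra {K u : Set (T × T)} (hρ : IsTopAction G T ρ) (hg : Good ρ K u) {p a b : T}
    (hab : a ≠ b) {ι : Type*} (V : Ultrafilter ι) (f : ι → G)
    (h1 : Tendsto (fun i => ρ (f i) p) V (𝓝 a))
    (h2 : ∀ N ∈ 𝓝 p, ∀ B ∈ 𝓝 b, ∀ᶠ i in (V : Filter ι), ∀ x ∉ N, ρ (f i) x ∈ B) :
    Con ρ K p := by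
  refine con_of hρ hg hab fun N hN A hA B hB => ?_
  obtain ⟨i, h3, h4⟩ := ((h1.eventually_mem hA).and (h2 N hN B hB)).exists
  exact ⟨f i, h3, h4⟩

/-- away from the repelling point, everything converges to the attracting point -/
lemma tendsto_of_cross [T2Space T] {ι : Type*} {V : Ultrafilter ι} {f : ι → G} {r b : T}
    (h : ∀ N ∈ 𝓝 r, ∀ B ∈ 𝓝 b, ∀ᶠ i in (V : Filter ι), ∀ x ∉ N, ρ (f i) x ∈ B)
    {s : ι → T} {x : T} (hs : Tendsto s V (𝓝 x)) (hx : x ≠ r) :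
    Tendsto (fun i => ρ (f i) (s i)) V (𝓝 b) := by
  intro B hB
  obtain ⟨U, N, hU, hN, hxU, hrN, hd⟩ := t2_separation hx
  change ∀ᶠ i in (V : Filter ι), ρ (f i) (s i) ∈ B
  filter_upwards [hs (hU.mem_nhds hxU), h N (hN.mem_nhds hrN) B hB] with i h1 h2
  exact h2 _ (fun h3 => hd.le_bot ⟨h1, h3⟩)

lemma con_of_stab [CompactSpace T] [T2Space T] [Infinite T] {K u : Set (T × T)}
    (hρ : IsTopAction G T ρ) (h3d : ThreeDisc fun (g : G) (x : T) => ρ g x)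
    (hg : Good ρ K u) {p q : T} (hpq : q ≠ p) {P : Set G} (hP : P.Infinite)
    (hp : ∀ g ∈ P, ρ g p = p) (hq : ∀ g ∈ P, ρ g q = q) : Con ρ K p := by
  obtain ⟨V, hV, hVP⟩ := exists_ultra hP
  obtain ⟨r, b, hrb⟩ := cross hρ h3d V id hV
  have key : ∀ x, (∀ g ∈ P, ρ g x = x) → x ≠ r → x = b := by
    intro x hx hxr
    have h1 := tendsto_of_cross hrb (s := fun _ => x) tendsto_const_nhds hxr
    have h2 : Tendsto (fun g : G => ρ (id g) x) V (𝓝 x) := by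
      refine tendsto_const_nhds.congr' ?_
      filter_upwards [hVP] with g hgP
      exact (hx g hgP).symm
    exact tendsto_nhds_unique h2 h1
  by_cases hr : r = p
  · subst hr
    obtain rfl := key q hq hpq
    refine con_of_ultra hρ hg hpq.symm V id ?_ hrb
    refine tendsto_const_nhds.congr' ?_
    filter_upwards [hVP] with g hgP
    exact (hp g hgP).symm
  · obtain rfl := key p hp (Ne.symm hr)
    have hqr : q = r := by
      by_contra h
      exact hpq (key q hq h)
    subst hqr
    refine con_of hρ hg hpq.symm fun N hN A hA B hB => ?_
    obtain ⟨g, h1, h2⟩ := (hVP.and (hrb B hB N hN)).exists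
    refine ⟨g⁻¹, ?_, fun x hx => ?_⟩
    · have : ρ g⁻¹ p = p := by
        conv_lhs => rw [← hp g h1]
        exact rho_inv_self hρ g p
      rw [this]; exact mem_of_mem_nhds hA
    · by_contra h
      have := h2 _ h
      simp only [id] at this
      rw [rho_self_inv hρ] at this
      exact hx this

lemma fin_pair [CompactSpace T] [T2Space T] [Infinite T] {K u : Set (T × T)}
    (hρ : IsTopAction G T ρ) (h3d : ThreeDisc fun (g : G) (x : T) => ρ g x)
    (hg : Good ρ K u) {p q q' : T} (hp : ¬ Con ρ K p) (hqq : q ≠ q') :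
    {g : G | (ρ g p, ρ g q) ∉ u ∧ (ρ g p, ρ g q') ∉ u}.Finite := by
  by_contra hinf
  obtain ⟨V, hV, hVP⟩ := exists_ultra hinf
  obtain ⟨r, b, hrb⟩ := cross hρ h3d V id hV
  obtain ⟨a, ha⟩ := exists_ulim V (fun g => ρ (id g) p)
  have key : ∀ x, (∀ᶠ g in (V : Filter G), (ρ g p, ρ g x) ∉ u) → x ≠ r → False := by
    intro x hx hxr
    have h1 := tendsto_of_cross hrb (s := fun _ => x) tendsto_const_nhds hxr
    have h2 : (a, b) ∈ uᶜ := hg.uop.isClosed_compl.mem_of_tendsto (ha.prodMk_nhds h1) hx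
    have hab : a ≠ b := by rintro rfl; exact h2 (hg.urefl a)
    have hpr : p = r := by
      by_contra hpr
      exact hab (tendsto_nhds_unique ha
        (tendsto_of_cross hrb (s := fun _ => p) tendsto_const_nhds hpr))
    subst hpr
    exact hp (con_of_ultra hρ hg hab V id ha hrb)
  by_cases h : q = r
  · exact key q' (hVP.mono fun g h => h.2) (fun h' => hqq (h.trans h'.symm))
  · exact key q (hVP.mono fun g h => h.1) h

/-- first element towards `p` -/
lemma exists_first [CompactSpace T] [T2Space T] [Infinite T] {K u : Set (T × T)}
    (hρ : IsTopAction G T ρ) (h3d : ThreeDisc fun (g : G) (x : T) => ρ g x)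
    (hg : Good ρ K u) {p q : T} (hp : ¬ Con ρ K p) (hqp : q ≠ p) :
    ∃ g, (ρ g p, ρ g q) ∉ u ∧ ∀ g', (∀ x, (ρ g p, ρ g x) ∉ u → (ρ g' p, ρ g' x) ∉ u) →
      ∀ x, (ρ g' p, ρ g' x) ∉ u → (ρ g p, ρ g x) ∉ u := by
  obtain ⟨g0, h0⟩ := hg.Kcov p q hqp.symm
  replace h0 := hg.K_disj h0
  obtain ⟨q', hqq, hq'⟩ : ∃ q', q ≠ q' ∧ (ρ g0 p, ρ g0 q') ∉ u := by
    obtain ⟨z, z', hz, h1, -, h2, -⟩ := hg.two (ρ g0 p) (ρ g0 p)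
    by_cases h : q = ρ g0⁻¹ z
    · refine ⟨ρ g0⁻¹ z', ?_, by rwa [rho_self_inv hρ]⟩
      rw [h]; exact fun h => hz ((ρ g0⁻¹).injective h)
    · exact ⟨_, h, by rwa [rho_self_inv hρ]⟩
  have hfin := fin_pair hρ h3d hg hp hqq
  obtain ⟨g, hgm, hmax⟩ := hfin.exists_maximalFor (fun g => {x | (ρ g p, ρ g x) ∉ u}) _ ⟨g0, h0, hq'⟩
  refine ⟨g, hgm.1, fun g' h => ?_⟩
  exact hmax (j := g') ⟨h q hgm.1, h q' hgm.2⟩ h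

lemma stab_infinite [CompactSpace T] [T2Space T] [Infinite T] {K u : Set (T × T)}
    (hρ : IsTopAction G T ρ) (h3d : ThreeDisc fun (g : G) (x : T) => ρ g x)
    (hg : Good ρ K u) {p : T} (hp : ¬ Con ρ K p) (hiso : (𝓝[≠] p).NeBot) :
    {g : G | ρ g p = p}.Infinite := by
  intro hfin
  have hfinb : ∀ b, {g : G | ρ g p = b}.Finite := by
    intro b
    by_cases h : ∃ k, ρ k p = b
    · obtain ⟨k, rfl⟩ := h
      refine (hfin.image (fun g => k * g)).subset fun g hgk => ⟨k⁻¹ * g, ?_, by simp⟩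
      change ρ (k⁻¹ * g) p = p
      rw [rho_mul hρ, show ρ g p = ρ k p from hgk, rho_inv_self hρ]
    · convert Set.finite_empty
      ext g; simp only [Set.mem_ofPred_eq, Set.mem_empty_iff_false, iff_false]
      exact fun h' => h ⟨g, h'⟩
  have : ∀ q, ∃ g, q ≠ p → (ρ g p, ρ g q) ∉ u ∧
      ∀ g', (∀ x, (ρ g p, ρ g x) ∉ u → (ρ g' p, ρ g' x) ∉ u) →
      ∀ x, (ρ g' p, ρ g' x) ∉ u → (ρ g p, ρ g x) ∉ u := by
    intro q
    by_cases hq : q = p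
    · exact ⟨1, fun h => (h hq).elim⟩
    · obtain ⟨g, h⟩ := exists_first hρ h3d hg hp hq
      exact ⟨g, fun _ => h⟩
  choose f hf using this
  let V : Ultrafilter T := Ultrafilter.of (𝓝[≠] p)
  have hVle : (V : Filter T) ≤ 𝓝[≠] p := Ultrafilter.of_le _
  have hVp : Tendsto (fun q : T => q) V (𝓝 p) := hVle.trans nhdsWithin_le_nhds
  have hVne : ∀ᶠ q in (V : Filter T), q ≠ p := hVle self_mem_nhdsWithin
  have hfk : ∀ k, ∀ᶠ q in (V : Filter T), f q ≠ k := by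
    intro k
    by_contra hcon
    rw [Ultrafilter.eventually_not.symm] at hcon
    push Not at hcon
    have h1 : Tendsto (fun q => (ρ k p, ρ k q)) V (𝓝 (ρ k p, ρ k p)) :=
      tendsto_const_nhds.prodMk_nhds (((ρ k).continuous.tendsto p).comp hVp)
    obtain ⟨q, h2, h3, h4⟩ := ((h1.eventually_mem (hg.uop.mem_nhds (hg.urefl _))).and (hcon.and hVne)).exists
    have := (hf q h4).1
    rw [h3] at this
    exact this h2
  obtain ⟨r, b, hrb⟩ := cross hρ h3d V f hfk
  obtain ⟨a, ha⟩ := exists_ulim V (fun q => ρ (f q) p)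
  obtain ⟨c, hc⟩ := exists_ulim V (fun q => ρ (f q) q)
  have hac : (a, c) ∈ uᶜ := hg.uop.isClosed_compl.mem_of_tendsto (ha.prodMk_nhds hc)
    (hVne.mono fun q h => (hf q h).1)
  have hrp : p = r := by
    by_contra hpr
    have h1 := tendsto_nhds_unique ha
        (tendsto_of_cross hrb (s := fun _ => p) tendsto_const_nhds hpr)
    have h2 := tendsto_nhds_unique hc (tendsto_of_cross hrb hVp hpr)
    rw [h1, h2] at hac
    exact hac (hg.urefl _)
  subst hrp
  have hab : a = b := by
    by_contra hab
    exact hp (con_of_ultra hρ hg hab V f ha hrb)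
  subst hab
  have hpa : ∀ᶠ q in (V : Filter T), ρ (f q) p ≠ a := by
    have := (eventually_all_finite (hfinb a)).2 (fun k _ => hfk k)
    filter_upwards [this] with q hq h
    exact hq _ h rfl
  have huV : {x | (a, x) ∈ u} ∈ 𝓝 a :=
    (Continuous.prodMk_right a).continuousAt (hg.uop.mem_nhds (hg.urefl a))
  obtain ⟨b1, hb1, hb1a⟩ : ∃ b1, (a, b1) ∈ u ∧ b1 ≠ a := by
    obtain ⟨q, h1, h2⟩ := ((ha.eventually_mem huV).and hpa).exists
    exact ⟨_, h1, h2⟩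
  obtain ⟨B0, hB0, hB0u⟩ : ∃ B ∈ 𝓝 a, B ×ˢ B ⊆ u := by
    obtain ⟨B1, h1, B2, h2, h⟩ := mem_nhds_prod_iff.1 (hg.uop.mem_nhds (hg.urefl a))
    exact ⟨B1 ∩ B2, inter_mem h1 h2, fun x hx => h ⟨hx.1.1, hx.2.2⟩⟩
  let B := B0 ∩ {b1}ᶜ
  have hB : B ∈ 𝓝 a := inter_mem hB0 (isOpen_compl_singleton.mem_nhds (Ne.symm hb1a))
  have hb1' : ∀ᶠ q in (V : Filter T), (ρ (f q) p, b1) ∈ u :=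
    (ha.prodMk_nhds tendsto_const_nhds) (hg.uop.mem_nhds hb1)
  have claim : ∀ᶠ q in (V : Filter T), ∃ h, ∀ x ∉ B, (ρ h (ρ (f q) p), ρ h x) ∉ u := by
    by_cases hCa : Con ρ K a
    · obtain ⟨β, b', hK, hcon⟩ := hCa
      obtain ⟨A, hA, B', hB', hsep⟩ := hg.sep _ _ hK
      obtain ⟨h, h1, h2⟩ := hcon B hB (interior A) (interior_mem_nhds.2 hA) B' hB'
      have : Tendsto (fun q => ρ h (ρ (f q) p)) V (𝓝 (ρ h a)) :=
        ((ρ h).continuous.tendsto a).comp ha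
      filter_upwards [this (isOpen_interior.mem_nhds h1)] with q hq
      exact ⟨h, fun x hx => hsep _ (interior_subset hq) _ (h2 x hx)⟩
    · have : ∀ q, ∃ h, ρ (f q) p ≠ a → (ρ h (ρ (f q) p), ρ h a) ∈ K := by
        intro q
        by_cases hq : ρ (f q) p = a
        · exact ⟨1, fun h => (h hq).elim⟩
        · obtain ⟨h, hh⟩ := hg.Kcov _ _ hq
          exact ⟨h, fun _ => hh⟩
      choose h hh using this
      have hhk : ∀ k, ∀ᶠ q in (V : Filter T), h q ≠ k := by
        intro k
        by_contra hcon
        rw [Ultrafilter.eventually_not.symm] at hcon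
        push Not at hcon
        have h1 : Tendsto (fun q => (ρ k (ρ (f q) p), ρ k a)) V (𝓝 (ρ k a, ρ k a)) :=
          (((ρ k).continuous.tendsto a).comp ha).prodMk_nhds tendsto_const_nhds
        refine hg.Kd _ (hg.Kcl.mem_of_tendsto h1 ?_)
        filter_upwards [hcon, hpa] with q h2 h3
        have := hh q h3
        rwa [h2] at this
      obtain ⟨r', b', hrb'⟩ := cross hρ h3d V h hhk
      obtain ⟨α, hα⟩ := exists_ulim V (fun q => ρ (h q) (ρ (f q) p))
      obtain ⟨β, hβ⟩ := exists_ulim V (fun q => ρ (h q) a)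
      have hK : (α, β) ∈ K := hg.Kcl.mem_of_tendsto (hα.prodMk_nhds hβ)
        (hpa.mono fun q h => hh q h)
      have hra : a = r' := by
        by_contra hne
        have h1 := tendsto_nhds_unique hα (tendsto_of_cross hrb' ha hne)
        have h2 := tendsto_nhds_unique hβ
          (tendsto_of_cross hrb' (s := fun _ => a) tendsto_const_nhds hne)
        rw [h1, h2] at hK
        exact hg.Kd _ hK
      subst hra
      have hβb : β = b' := by
        by_contra hne
        exact hCa (con_of_ultra hρ hg hne V h hβ hrb')
      subst hβb
      obtain ⟨A, hA, B', hB', hsep⟩ := hg.sep _ _ hK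
      filter_upwards [hα hA, hrb' B hB B' hB'] with q h1 h2
      exact ⟨h q, fun x hx => hsep _ h1 _ (h2 x hx)⟩
  obtain ⟨q, ⟨h, hh⟩, hqu, hqp, hqB⟩ :=
    (claim.and (hb1'.and (hVne.and (ha hB)))).exists
  have h1 := (hf q hqp).2 (h * f q) (fun x hx => by
    simp only [rho_mul hρ]
    exact hh _ (fun hxB => hx (hB0u ⟨hqB.1, hxB.1⟩))) (ρ (f q)⁻¹ b1) (by
    simp only [rho_mul hρ, rho_self_inv hρ]
    exact hh _ (fun hxB => hxB.2 rfl))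
  rw [rho_self_inv hρ] at h1
  exact h1 hqu

end
end RHG

namespace RHG
open Filter Topology Set

set_option linter.unusedSectionVars false

section
variable {G : Type*} [Group G] {T : Type*} [TopologicalSpace T]
  {ρ : G → T ≃ₜ T}

lemma exists_good [CompactSpace T] [T2Space T] [Infinite T]
    (h2c : TwoCocompact fun (g : G) (x : T) => ρ g x) : ∃ K u, Good ρ K u := by
  obtain ⟨K, hK, hKd, hcov⟩ := h2c
  let _ : UniformSpace T := uniformSpaceOfCompactR1
  let e : Fin 4 ↪ T := (Fin.valEmbedding).trans (Infinite.natEmbedding T)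
  let E : Set (T × T) := (fun ij : Fin 4 × Fin 4 => (e ij.1, e ij.2)) '' {ij | ij.1 ≠ ij.2}
  have hE : E.Finite := (Set.toFinite _).image _
  have hcl : IsClosed (K ∪ E) := hK.isClosed.union hE.isClosed
  have hdd : ∀ x, (x, x) ∉ K ∪ E := by
    rintro x (h | ⟨⟨i, j⟩, hij, h⟩)
    · exact hKd h rfl
    · simp only [Prod.mk.injEq] at h
      exact hij (e.injective (h.1.trans h.2.symm))
  have hU : (K ∪ E)ᶜ ∈ uniformity T := by
    rw [← nhdsSet_diagonal_eq_uniformity]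
    refine hcl.isOpen_compl.mem_nhdsSet.2 ?_
    rintro ⟨x, y⟩ (h : x = y)
    subst h; exact hdd x
  obtain ⟨v, hv, hvo⟩ := comp_mem_uniformity_sets hU
  obtain ⟨w, hw, hwo⟩ := comp_mem_uniformity_sets hv
  obtain ⟨u, hu, huo, hus, huc⟩ := comp_open_symm_mem_uniformity_sets hw
  have hrefl : ∀ x, (x, x) ∈ u := fun x => refl_mem_uniformity hu
  have hsymm : ∀ x y, (x, y) ∈ u → (y, x) ∈ u := fun x y h => SetRel.symm u h
  have h2 : ∀ x y z, (x, y) ∈ u → (y, z) ∈ u → (x, z) ∈ w := fun x y z h1 h2 =>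
    huc ⟨y, h1, h2⟩
  have h4 : ∀ x y z t, (x, y) ∈ u → (y, z) ∈ u → (z, t) ∈ u → (x, t) ∉ K ∪ E :=
    fun x y z t h1 h3 h5 => hvo ⟨z, hwo ⟨z, h2 _ _ _ h1 h3, refl_mem_uniformity hw⟩,
      hwo ⟨t, h2 _ _ _ h5 (hrefl t), refl_mem_uniformity hw⟩⟩
  refine ⟨K, u, ?_, hK.isClosed, fun x h => hKd h rfl, huo, hsymm, hrefl, ?_, ?_⟩
  · intro x y hxy
    exact hcov (x, y) hxy
  · intro a b hab
    refine ⟨{x | (a, x) ∈ u}, (Continuous.prodMk_right a).continuousAt (huo.mem_nhds (hrefl a)),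
      {x | (b, x) ∈ u}, (Continuous.prodMk_right b).continuousAt (huo.mem_nhds (hrefl b)), ?_⟩
    intro x hx y hy hxy
    exact h4 a x y b hx hxy (hsymm _ _ hy) (Or.inl hab)
  · intro x y
    have key : ∀ x i j, (x, e i) ∈ u → (x, e j) ∈ u → i = j := by
      intro x i j hi hj
      by_contra hne
      exact h4 (e i) x (e j) (e j) (hsymm _ _ hi) hj (hrefl _) (Or.inr ⟨(i, j), hne, rfl⟩)
    have hc : ∀ x, ∃ k, ∀ i, i ≠ k → (x, e i) ∉ u := by
      intro x
      by_cases h : ∃ k, (x, e k) ∈ u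
      · obtain ⟨k, hk⟩ := h
        exact ⟨k, fun i hi h => hi (key x i k h hk)⟩
      · push Not at h
        exact ⟨0, fun i _ => h i⟩
    obtain ⟨k, hk⟩ := hc x
    obtain ⟨l, hl⟩ := hc y
    obtain ⟨i, j, hij, h1, h2, h3, h4⟩ : ∃ i j : Fin 4, i ≠ j ∧ i ≠ k ∧ i ≠ l ∧ j ≠ k ∧ j ≠ l := by
      exact (by decide : ∀ k l : Fin 4, ∃ i j : Fin 4, i ≠ j ∧ i ≠ k ∧ i ≠ l ∧ j ≠ k ∧ j ≠ l) k l
    exact ⟨e i, e j, fun h => hij (e.injective h), hk i h1, hl i h2, hk j h3, hl j h4⟩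

lemma fin4 [CompactSpace T] [T2Space T] [Infinite T] {K u : Set (T × T)}
    (hρ : IsTopAction G T ρ) (h3d : ThreeDisc fun (g : G) (x : T) => ρ g x)
    (hg : Good ρ K u) {x y z z' : T} (hxy : x ≠ y) (hz : z ≠ z') :
    {g : G | ((ρ g x, ρ g z) ∉ u ∧ (ρ g y, ρ g z) ∉ u) ∧
      ((ρ g x, ρ g z') ∉ u ∧ (ρ g y, ρ g z') ∉ u)}.Finite := by
  by_contra hinf
  obtain ⟨V, hV, hVP⟩ := exists_ultra hinf
  obtain ⟨r, b, hrb⟩ := cross hρ h3d V id hV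
  have key : ∀ x z, x ≠ r → z ≠ r → (∀ᶠ g in (V : Filter G), (ρ g x, ρ g z) ∉ u) → False := by
    intro x z hx hz h
    have h1 := tendsto_of_cross hrb (s := fun _ => x) tendsto_const_nhds hx
    have h2 := tendsto_of_cross hrb (s := fun _ => z) tendsto_const_nhds hz
    exact hg.uop.isClosed_compl.mem_of_tendsto (h1.prodMk_nhds h2) h (hg.urefl b)
  have hx : ∃ x', (x' = x ∨ x' = y) ∧ x' ≠ r := by
    by_cases h : x = r
    · exact ⟨y, Or.inr rfl, fun h' => hxy (h.trans h'.symm)⟩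
    · exact ⟨x, Or.inl rfl, h⟩
  have hz : ∃ x', (x' = z ∨ x' = z') ∧ x' ≠ r := by
    by_cases h : z = r
    · exact ⟨z', Or.inr rfl, fun h' => hz (h.trans h'.symm)⟩
    · exact ⟨z, Or.inl rfl, h⟩
  obtain ⟨a, ha, har⟩ := hx
  obtain ⟨c, hc, hcr⟩ := hz
  refine key a c har hcr (hVP.mono fun g h => ?_)
  rcases ha with rfl | rfl <;> rcases hc with rfl | rfl
  · exact h.1.1
  · exact h.2.1
  · exact h.1.2
  · exact h.2.2

lemma expand [CompactSpace T] [T2Space T] {K u : Set (T × T)}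
    (hg : Good ρ K u) (hcon : ∀ p : T, (𝓝[≠] p).NeBot → Con ρ K p)
    {w : Set (T × T)} (hwo : IsOpen w) (hwr : ∀ x, (x, x) ∈ w) :
    ∃ (S : Set G) (w' : Set (T × T)), S.Finite ∧ IsOpen w' ∧ (∀ x, (x, x) ∈ w') ∧
      (∀ x y, (x, y) ∈ w' → (y, x) ∈ w') ∧
      ∀ x y, x ≠ y → (x, y) ∈ w' → ∃ s ∈ S,
        (∀ z, (x, z) ∉ w → (ρ s x, ρ s z) ∉ u ∧ (ρ s y, ρ s z) ∉ u) ∧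
        ∃ z, (x, z) ∈ w ∧ (ρ s x, ρ s z) ∉ u := by
  have local_ : ∀ p : T, ∃ (O : Set T) (s : G), IsOpen O ∧ p ∈ O ∧ ∀ x ∈ O, ∀ y ∈ O, x ≠ y →
        (∀ z, (x, z) ∉ w → (ρ s x, ρ s z) ∉ u ∧ (ρ s y, ρ s z) ∉ u) ∧
        ∃ z, (x, z) ∈ w ∧ (ρ s x, ρ s z) ∉ u := by
    intro p
    by_cases hp : (𝓝[≠] p).NeBot
    · obtain ⟨P, hP, hPw⟩ : ∃ P ∈ 𝓝 p, P ×ˢ P ⊆ w := by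
        obtain ⟨B1, h1, B2, h2, h⟩ := mem_nhds_prod_iff.1 (hwo.mem_nhds (hwr p))
        exact ⟨B1 ∩ B2, inter_mem h1 h2, fun x hx => h ⟨hx.1.1, hx.2.2⟩⟩
      obtain ⟨t, htP, htp⟩ : ∃ t ∈ P, t ≠ p := by
        have := (nhdsWithin_le_nhds hP : P ∈ 𝓝[≠] p)
        obtain ⟨t, h1, h2⟩ := hp.nonempty_of_mem (inter_mem this self_mem_nhdsWithin)
        exact ⟨t, h1, h2⟩
      have hN : P ∩ {t}ᶜ ∈ 𝓝 p := inter_mem hP (isOpen_compl_singleton.mem_nhds (Ne.symm htp))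
      obtain ⟨a, b, hab, h⟩ := hcon p hp
      obtain ⟨A, hA, B, hB, hsep⟩ := hg.sep a b hab
      obtain ⟨g, hgp, hgN⟩ := h _ hN _ (interior_mem_nhds.2 hA) B hB
      refine ⟨interior P ∩ (ρ g) ⁻¹' (interior A), g, isOpen_interior.inter
        (isOpen_interior.preimage (ρ g).continuous), ⟨mem_interior_iff_mem_nhds.2 hP, hgp⟩, ?_⟩
      intro x hx y hy hxy
      refine ⟨fun z hz => ?_, t, hPw ⟨interior_subset hx.1, htP⟩,
        hsep _ (interior_subset hx.2) _ (hgN t fun h => h.2 rfl)⟩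
      have hzB : ρ g z ∈ B := hgN z fun h => hz (hPw ⟨interior_subset hx.1, h.1⟩)
      exact ⟨hsep _ (interior_subset hx.2) _ hzB, hsep _ (interior_subset hy.2) _ hzB⟩
    · refine ⟨{p}, 1, ?_, rfl, ?_⟩
      · rw [not_neBot] at hp
        exact (isOpen_singleton_iff_punctured_nhds p).2 hp
      · rintro x rfl y rfl h
        exact (h rfl).elim
  choose O s hO hpO hs using local_
  obtain ⟨t, ht⟩ := isCompact_univ.elim_finite_subcover O hO (fun x _ => mem_iUnion.2 ⟨x, hpO x⟩)
  refine ⟨s '' t, ⋃ p ∈ t, O p ×ˢ O p, t.finite_toSet.image s,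
    isOpen_biUnion fun p _ => (hO p).prod (hO p), ?_, ?_, ?_⟩
  · intro x
    obtain ⟨p, hp, hx⟩ := mem_iUnion₂.1 (ht (mem_univ x))
    exact mem_iUnion₂.2 ⟨p, hp, hx, hx⟩
  · intro x y h
    obtain ⟨p, hp, hx, hy⟩ := mem_iUnion₂.1 h
    exact mem_iUnion₂.2 ⟨p, hp, hy, hx⟩
  · intro x y hxy h
    obtain ⟨p, hp, hx, hy⟩ := mem_iUnion₂.1 h
    exact ⟨s p, ⟨p, hp, rfl⟩, hs p x hx y hy hxy⟩

lemma iterate [CompactSpace T] [T2Space T] [Infinite T] {K u : Set (T × T)}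
    (hρ : IsTopAction G T ρ) (h3d : ThreeDisc fun (g : G) (x : T) => ρ g x)
    (hg : Good ρ K u) {w' : Set (T × T)} (H : Subgroup G)
    (hS : ∀ x y, x ≠ y → (x, y) ∈ w' → ∃ s ∈ H,
        (∀ z, (x, z) ∉ u → (ρ s x, ρ s z) ∉ u ∧ (ρ s y, ρ s z) ∉ u) ∧
        ∃ z, (x, z) ∈ u ∧ (ρ s x, ρ s z) ∉ u) (x y : T) (hxy : x ≠ y) :
    ∃ h ∈ H, (ρ h x, ρ h y) ∉ w' ∧ ∀ z, (x, z) ∉ u → (y, z) ∉ u →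
      (ρ h x, ρ h z) ∉ u ∧ (ρ h y, ρ h z) ∉ u := by
  obtain ⟨z, z', hzz, hxz, hyz, hxz', hyz'⟩ := hg.two x y
  let 𝓗 : Set G := {h | h ∈ H ∧ ∀ z, (x, z) ∉ u → (y, z) ∉ u →
      (ρ h x, ρ h z) ∉ u ∧ (ρ h y, ρ h z) ∉ u}
  have hfin : 𝓗.Finite := (fin4 hρ h3d hg hxy hzz).subset fun g hgH =>
    ⟨hgH.2 z hxz hyz, hgH.2 z' hxz' hyz'⟩
  have hne : 𝓗.Nonempty := ⟨1, H.one_mem, fun z h1 h2 => by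
    simp only [rho_one hρ]; exact ⟨h1, h2⟩⟩
  obtain ⟨h, hh, hmax⟩ := hfin.exists_maximalFor (fun g => {z | (ρ g x, ρ g z) ∉ u}) _ hne
  refine ⟨h, hh.1, fun hw => ?_, hh.2⟩
  obtain ⟨s, hsH, hs, z1, hz1, hz1'⟩ := hS _ _ (fun e => hxy ((ρ h).injective e)) hw
  have hm : s * h ∈ 𝓗 := by
    refine ⟨H.mul_mem hsH hh.1, fun z h1 h2 => ?_⟩
    simp only [rho_mul hρ]
    exact hs _ (hh.2 z h1 h2).1
  have := hmax hm (fun z hz => by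
    change (ρ (s * h) x, ρ (s * h) z) ∉ u
    simp only [rho_mul hρ]
    exact (hs _ hz).1) (show ρ h⁻¹ z1 ∈ _ by
    change (ρ (s * h) x, ρ (s * h) (ρ h⁻¹ z1)) ∉ u
    simp only [rho_mul hρ, rho_self_inv hρ]
    exact hz1')
  change (ρ h x, ρ h (ρ h⁻¹ z1)) ∉ u at this
  rw [rho_self_inv hρ] at this
  exact this hz1

lemma main_infinite [CompactSpace T] [T2Space T] [Infinite T] {K u : Set (T × T)}
    (hρ : IsTopAction G T ρ) (h3d : ThreeDisc fun (g : G) (x : T) => ρ g x)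
    (hg : Good ρ K u) (hcon : ∀ p : T, (𝓝[≠] p).NeBot → Con ρ K p) : Group.FG G := by
  obtain ⟨S1, w1, hS1, hw1o, hw1r, hw1s, hw1⟩ := expand hg hcon hg.uop hg.urefl
  obtain ⟨S2, w2, hS2, hw2o, hw2r, hw2s, hw2⟩ := expand hg hcon hw1o hw1r
  let H := Subgroup.closure (S1 ∪ S2)
  have hI := iterate hρ h3d hg (w' := w1) H (fun x y hxy h => by
    obtain ⟨s, hs, h'⟩ := hw1 x y hxy h
    exact ⟨s, Subgroup.subset_closure (Or.inl hs), h'⟩)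
  let W := u ∩ (w1 ∩ w2)
  have hWo : IsOpen W := hg.uop.inter (hw1o.inter hw2o)
  have hWs : ∀ x y, (x, y) ∈ W → (y, x) ∈ W := fun x y h =>
    ⟨hg.usymm _ _ h.1, hw1s _ _ h.2.1, hw2s _ _ h.2.2⟩
  have hu : ∀ {x y}, (x, y) ∉ u → (x, y) ∉ W := fun h h' => h h'.1
  have h1 : ∀ {x y}, (x, y) ∉ w1 → (x, y) ∉ W := fun h h' => h h'.2.1
  have h2 : ∀ {x y}, (x, y) ∉ w2 → (x, y) ∉ W := fun h h' => h h'.2.2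
  have hs : ∀ {x y}, (x, y) ∉ W → (y, x) ∉ W := fun h h' => h (hWs _ _ h')
  have stepA : ∀ x y z, x ≠ z → (x, z) ∈ w2 → (x, y) ∉ w1 → ∃ h ∈ H,
      (ρ h x, ρ h y) ∉ W ∧ (ρ h x, ρ h z) ∉ W ∧ (ρ h y, ρ h z) ∉ W := by
    intro x y z hxz hxzw hxy
    obtain ⟨s, hsS, hsz, -⟩ := hw2 x z hxz hxzw
    obtain ⟨h, hH, ha, hb⟩ := hI (ρ s x) (ρ s z) (fun e => hxz ((ρ s).injective e))
    obtain ⟨hc, hd⟩ := hb (ρ s y) (hsz y hxy).1 (hsz y hxy).2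
    refine ⟨h * s, H.mul_mem hH (Subgroup.subset_closure (Or.inr hsS)), ?_⟩
    simp only [rho_mul hρ]
    exact ⟨hu hc, h1 ha, hs (hu hd)⟩
  have stepB : ∀ x y z, x ≠ y → x ≠ z → y ≠ z → ∃ h ∈ H,
      (ρ h x, ρ h y) ∉ W ∧ (ρ h x, ρ h z) ∉ W ∧ (ρ h y, ρ h z) ∉ W := by
    intro x y z hxy hxz hyz
    obtain ⟨k, hk, hkw, -⟩ := hI x y hxy
    have hxz' : ρ k x ≠ ρ k z := fun e => hxz ((ρ k).injective e)
    have hyz' : ρ k y ≠ ρ k z := fun e => hyz ((ρ k).injective e)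
    by_cases c1 : (ρ k x, ρ k z) ∈ w2
    · obtain ⟨h, hH, e1, e2, e3⟩ := stepA _ _ _ hxz' c1 hkw
      refine ⟨h * k, H.mul_mem hH hk, ?_⟩
      simp only [rho_mul hρ]
      exact ⟨e1, e2, e3⟩
    by_cases c2 : (ρ k y, ρ k z) ∈ w2
    · obtain ⟨h, hH, e1, e2, e3⟩ := stepA _ (ρ k x) _ hyz' c2 (fun h => hkw (hw1s _ _ h))
      refine ⟨h * k, H.mul_mem hH hk, ?_⟩
      simp only [rho_mul hρ]
      exact ⟨hs e1, e3, e2⟩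
    exact ⟨k, hk, h1 hkw, h2 c1, h2 c2⟩
  obtain ⟨e⟩ : Nonempty (ℕ ↪ T) := ⟨Infinite.natEmbedding T⟩
  have he : ∀ i j : ℕ, i ≠ j → e i ≠ e j := fun i j h h' => h (e.injective h')
  let L : Set (T × T × T) := {t | (t.1, t.2.1) ∉ W ∧ (t.1, t.2.2) ∉ W ∧ (t.2.1, t.2.2) ∉ W}
  have hWr : ∀ x, (x, x) ∈ W := fun x => ⟨hg.urefl x, hw1r x, hw2r x⟩
  have hLc : IsClosed L := by
    refine IsClosed.inter ?_ (IsClosed.inter ?_ ?_)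
    · exact hWo.isClosed_compl.preimage (f := fun t : T × T × T => (t.1, t.2.1)) (by fun_prop)
    · exact hWo.isClosed_compl.preimage (f := fun t : T × T × T => (t.1, t.2.2)) (by fun_prop)
    · exact hWo.isClosed_compl.preimage (f := fun t : T × T × T => (t.2.1, t.2.2)) (by fun_prop)
  have hne : ∀ {x y}, (x, y) ∉ W → x ≠ y := by
    rintro x y h rfl
    exact h (hWr x)
  have hfin := h3d (L ∪ {(e 0, e 1, e 2)}) (hLc.isCompact.union isCompact_singleton) (by
    rintro t (ht | ht)
    · exact ⟨hne ht.1, hne ht.2.1, hne ht.2.2⟩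
    · rw [mem_singleton_iff.1 ht]
      exact ⟨he _ _ (by simp), he _ _ (by simp), he _ _ (by simp)⟩)
  set F := {g : G | (((fun x : T × T × T => (ρ g x.1, ρ g x.2.1, ρ g x.2.2)) ''
    (L ∪ {(e 0, e 1, e 2)})) ∩ (L ∪ {(e 0, e 1, e 2)})).Nonempty} with hF
  rw [Group.fg_iff]
  refine ⟨S1 ∪ S2 ∪ F, ?_, (hS1.union hS2).union hfin⟩
  rw [eq_top_iff]
  intro g _
  obtain ⟨h, hH, e1, e2, e3⟩ := stepB (ρ g (e 0)) (ρ g (e 1)) (ρ g (e 2))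
    (fun e' => he 0 1 (by simp) ((ρ g).injective e'))
    (fun e' => he 0 2 (by simp) ((ρ g).injective e'))
    (fun e' => he 1 2 (by simp) ((ρ g).injective e'))
  have hmem : h * g ∈ F := by
    refine ⟨(ρ (h * g) (e 0), ρ (h * g) (e 1), ρ (h * g) (e 2)),
      ⟨(e 0, e 1, e 2), Or.inr rfl, rfl⟩, Or.inl ?_⟩
    simp only [rho_mul hρ]
    exact ⟨e1, e2, e3⟩
  have : g = h⁻¹ * (h * g) := by group
  rw [this]
  exact Subgroup.mul_mem _ (Subgroup.inv_mem _ (Subgroup.closure_mono subset_union_left hH))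
    (Subgroup.subset_closure (Or.inr hmem))

end
end RHG

namespace RHG

/-- A group `G` acting 3-discontinuously and 2-cocompactly on a compactum `T` without
parabolic points is finitely generated. -/
theorem finitely_generated_of_no_parabolics {G : Type*} [Group G]
    {T : Type*} [TopologicalSpace T] [CompactSpace T] [T2Space T] (h3 : HasThreePts T)
    (ρ : G → T ≃ₜ T) (hρ : IsTopAction G T ρ)
    (h3d : ThreeDisc fun (g : G) (x : T) => ρ g x)
    (h2c : TwoCocompact fun (g : G) (x : T) => ρ g x)
    (hnopar : ∀ p : T, ¬ IsParabolicPt ρ hρ p) :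
    Group.FG G := by
  rcases finite_or_infinite T with hT | hT
  · obtain ⟨x, y, z, hxy, hxz, hyz⟩ := h3
    have hfin := h3d distinct3 (Set.toFinite _).isCompact subset_rfl
    have : Finite G := by
      rw [← Set.finite_univ_iff]
      refine hfin.subset fun g _ => ?_
      refine ⟨(ρ g x, ρ g y, ρ g z), ⟨(x, y, z), ⟨hxy, hxz, hyz⟩, rfl⟩, ?_⟩
      exact ⟨fun h => hxy ((ρ g).injective h), fun h => hxz ((ρ g).injective h),
        fun h => hyz ((ρ g).injective h)⟩
    infer_instance
  · obtain ⟨K, u, hg⟩ := exists_good h2c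
    refine main_infinite hρ h3d hg fun p hp => ?_
    by_contra hc
    have hinf := stab_infinite hρ h3d hg hc hp
    refine hnopar p ⟨hinf, fun q hq => ?_⟩
    by_contra hqp
    exact hc (con_of_stab hρ h3d hg hqp hinf (fun g h => h) hq)

end RHG
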